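/- Let H be a separable complex Hilbert space and let lim_ω be an extended limit. Then the formula Tr_ω(A) := lim_ω ( (1/log(N+1)) ∑_{j<N} λ_j(A) )_{N≥1}, where (λ_j(A))_{j≥0} is any eigenvalue sequence of A, is independent of the choice of eigenvalue sequence and defines a positive linear trace Tr_ω : 𝓛_{1,∞} → ℂ; that is, Tr_ω is additive and homogeneous on 𝓛_{1,∞}, Tr_ω(T) ≥ 0 for every positive T ∈ 𝓛_{1,∞}, and Tr_ω(BT) = Tr_ω(TB) for every bounded operator B and every T ∈ 𝓛_{1,∞}. -/

import Mathlib

open Filter MeasureTheory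

universe u v

/-- Singular values via the Courant–Fischer / approximation-number formula:
`μ_j(T) = inf { sup { ‖Tξ‖ : ξ ∈ Eᗮ, ‖ξ‖ = 1 } : dim E = j }`. -/
noncomputable def sv {H : Type u} [NormedAddCommGroup H] [InnerProductSpace ℂ H]
    (T : H →L[ℂ] H) (j : ℕ) : ℝ :=
  ⨅ E : {E : Submodule ℂ H // Module.finrank ℂ E = j},
    ⨆ ξ : {ξ : H // ξ ∈ (E.1)ᗮ ∧ ‖ξ‖ = 1}, ‖T ξ.1‖

/-- Membership in the weak Schatten class `𝓛_{p,∞}`: compactness together with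
`sup_j (j+1)^{1/p} μ_j(T) < ∞`. -/
def MemWeak {H : Type u} [NormedAddCommGroup H] [InnerProductSpace ℂ H]
    (p : ℝ) (T : H →L[ℂ] H) : Prop :=
  IsCompactOperator ⇑T ∧ ∃ C : ℝ, ∀ j : ℕ, ((j : ℝ) + 1) ^ (1 / p) * sv T j ≤ C

/-- Algebraic multiplicity of `z` as an eigenvalue of `A`:
the dimension of `⋃_{ℓ ≥ 1} ker (A - z)^ℓ`. -/
noncomputable def algMult {H : Type u} [NormedAddCommGroup H] [InnerProductSpace ℂ H]
    (A : H →L[ℂ] H) (z : ℂ) : Cardinal.{u} :=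
  Module.rank ℂ
    ↥(⨆ ℓ : ℕ, LinearMap.ker (((A : H →ₗ[ℂ] H) - z • LinearMap.id) ^ ℓ))

/-- `lam` is an eigenvalue sequence of `A`: the moduli `‖lam j‖` are nonincreasing and every
nonzero `z ∈ ℂ` occurs in `lam` exactly `algMult A z` times (so the nonzero eigenvalues are
listed with algebraic multiplicity in order of decreasing modulus, padded with zeros). -/
def IsEigenvalueSequence {H : Type u} [NormedAddCommGroup H] [InnerProductSpace ℂ H]
    (A : H →L[ℂ] H) (lam : ℕ → ℂ) : Prop :=
  (∀ j, ‖lam (j + 1)‖ ≤ ‖lam j‖) ∧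
  ∀ z : ℂ, z ≠ 0 →
    Cardinal.lift.{u} (Cardinal.mk {j : ℕ // lam j = z}) = Cardinal.lift.{0} (algMult A z)

/-- An extended limit: a positive linear functional on `ℓ_∞` extending the limit functional,
here encoded as a total function on sequences that is linear and positive on bounded sequences,
is unital, and vanishes on sequences converging to `0`. -/
structure IsExtendedLimit (ω : (ℕ → ℂ) → ℂ) : Prop where
  map_add : ∀ a b : ℕ → ℂ, (∃ C : ℝ, ∀ n, ‖a n‖ ≤ C) → (∃ C : ℝ, ∀ n, ‖b n‖ ≤ C) →
    ω (a + b) = ω a + ω b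
  map_smul : ∀ (c : ℂ) (a : ℕ → ℂ), (∃ C : ℝ, ∀ n, ‖a n‖ ≤ C) → ω (c • a) = c * ω a
  pos : ∀ a : ℕ → ℂ, (∃ C : ℝ, ∀ n, ‖a n‖ ≤ C) → (∀ n, ∃ r : ℝ, 0 ≤ r ∧ a n = r) →
    ∃ s : ℝ, 0 ≤ s ∧ ω a = s
  unital : ω (fun _ => (1 : ℂ)) = 1
  vanishing : ∀ a : ℕ → ℂ, Tendsto a atTop (nhds 0) → ω a = 0

/-- The logarithmic Cesàro means `N ↦ (1/log (N+1)) ∑_{j<N} lam j` of a sequence. -/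
noncomputable def cesaro (lam : ℕ → ℂ) : ℕ → ℂ :=
  fun N => (((Real.log ((N : ℝ) + 1))⁻¹ : ℝ) : ℂ) * ∑ j ∈ Finset.range N, lam j

section GenEigenspaces

open Module Module.End

variable {M : Type u} [AddCommGroup M] [Module ℂ M]

/-- The span of all generalized eigenspaces of `f` for eigenvalues of modulus larger than `r`. -/
def outerSpace (f : End ℂ M) (r : ℝ) : Submodule ℂ M :=
  ⨆ μ : {μ : ℂ // r < ‖μ‖}, f.maxGenEigenspace μ

lemma maxGenEigenspace_le_outerSpace (f : End ℂ M) {r : ℝ} {μ : ℂ} (h : r < ‖μ‖) :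
    f.maxGenEigenspace μ ≤ outerSpace f r :=
  le_iSup (fun μ : {μ : ℂ // r < ‖μ‖} => f.maxGenEigenspace μ) ⟨μ, h⟩

lemma map_mem_maxGenEigenspace (f : End ℂ M) {μ : ℂ} {x : M} (hx : x ∈ f.maxGenEigenspace μ) :
    f x ∈ f.maxGenEigenspace μ :=
  mapsTo_maxGenEigenspace_of_comm (Commute.refl f) μ hx

lemma map_mem_outerSpace (f : End ℂ M) (r : ℝ) {x : M} (hx : x ∈ outerSpace f r) :
    f x ∈ outerSpace f r := by
  induction hx using Submodule.iSup_induction' with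
  | mem μ x hx => exact maxGenEigenspace_le_outerSpace f μ.2 (map_mem_maxGenEigenspace f hx)
  | zero => simp
  | add x y _ _ hx hy => simpa using add_mem hx hy

lemma exists_map_sub_smul_eq (f : End ℂ M) {μ ν : ℂ} (h : ν ≠ μ) (k : ℕ) :
    ∀ x, ((f - ν • 1) ^ k) x = 0 → ∃ y ∈ f.maxGenEigenspace ν, f y - μ • y = x := by
  induction k with
  | zero => intro x hx; exact ⟨0, zero_mem _, by simpa using hx.symm⟩
  | succ k ih =>
    intro x hx
    obtain ⟨y, hy, hyx⟩ := ih (f x - ν • x) (by simpa [pow_succ] using hx)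
    refine ⟨(ν - μ)⁻¹ • (x - y), Submodule.smul_mem _ _ (sub_mem ?_ hy), ?_⟩
    · exact (mem_maxGenEigenspace f ν x).2 ⟨k + 1, hx⟩
    · have h' : ν - μ ≠ 0 := sub_ne_zero.2 h
      have : f y = f x - ν • x + μ • y := by rw [← hyx]; abel
      rw [map_smul, map_sub, this, smul_comm μ, ← smul_sub]
      have : f x - (f x - ν • x + μ • y) - μ • (x - y) = (ν - μ) • x := by module
      rw [this, smul_smul, inv_mul_cancel₀ h', one_smul]

/-- If `f x - μ x` lies in the outer space and `μ` has modulus larger than `r`, so does `x`. -/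
lemma mem_outerSpace_of_map_sub_smul_mem (f : End ℂ M) {r : ℝ} {μ : ℂ} (hμ : r < ‖μ‖) {x : M}
    (hx : f x - μ • x ∈ outerSpace f r) : x ∈ outerSpace f r := by
  have key : ∀ v ∈ outerSpace f r, ∃ y ∈ outerSpace f r, ∃ w ∈ f.maxGenEigenspace μ,
      v = f y - μ • y + w := by
    intro v hv
    induction hv using Submodule.iSup_induction' with
    | mem ν x hx =>
      by_cases h : (ν : ℂ) = μ
      · exact ⟨0, zero_mem _, x, h ▸ hx, by simp⟩
      · obtain ⟨k, hk⟩ := (mem_maxGenEigenspace f _ x).1 hx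
        obtain ⟨y, hy, rfl⟩ := exists_map_sub_smul_eq f h k x hk
        exact ⟨y, maxGenEigenspace_le_outerSpace f ν.2 hy, 0, zero_mem _, by simp⟩
    | zero => exact ⟨0, zero_mem _, 0, zero_mem _, by simp⟩
    | add x x' _ _ hx hx' =>
      obtain ⟨y, hy, w, hw, rfl⟩ := hx
      obtain ⟨y', hy', w', hw', rfl⟩ := hx'
      refine ⟨y + y', add_mem hy hy', w + w', add_mem hw hw', ?_⟩
      rw [map_add]; module
  obtain ⟨y, hy, w, hw, h⟩ := key _ hx
  have hxy : x - y ∈ f.maxGenEigenspace μ := by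
    obtain ⟨k, hk⟩ := (mem_maxGenEigenspace f _ w).1 hw
    refine (mem_maxGenEigenspace f _ _).2 ⟨k + 1, ?_⟩
    have : (f - μ • (1 : End ℂ M)) (x - y) = w := by
      have : w = f x - μ • x - (f y - μ • y) := by rw [h]; abel
      rw [this]; simp only [LinearMap.sub_apply, LinearMap.smul_apply, Module.End.one_apply, map_sub]
    rw [pow_succ, Module.End.mul_apply, this, hk]
  simpa using add_mem (maxGenEigenspace_le_outerSpace f hμ hxy) hy

lemma disjoint_maxGenEigenspace_outerSpace (f : End ℂ M) {r : ℝ} {μ : ℂ} (hμ : ¬ r < ‖μ‖) :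
    Disjoint (f.maxGenEigenspace μ) (outerSpace f r) := by
  refine (f.independent_maxGenEigenspace μ).mono_right ?_
  refine iSup_le fun ν => le_iSup₂_of_le (ν : ℂ) ?_ le_rfl
  rintro rfl
  exact hμ ν.2

lemma lt_norm_of_mem_outerSpace (f : End ℂ M) {r : ℝ} {μ : ℂ} {x : M} (hx : x ∈ outerSpace f r)
    (hx0 : x ≠ 0) (h : f x = μ • x) : r < ‖μ‖ := by
  by_contra hμ
  refine hx0 (Submodule.disjoint_def.1 (disjoint_maxGenEigenspace_outerSpace f hμ) x ?_ hx)
  exact (mem_maxGenEigenspace f _ _).2 ⟨1, by simp [h]⟩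

/-- Every element of the outer space lies in a finite-dimensional invariant subspace of it. -/
lemma exists_finiteDimensional_invariant (f : End ℂ M) (r : ℝ) {x : M}
    (hx : x ∈ outerSpace f r) :
    ∃ W : Submodule ℂ M, FiniteDimensional ℂ W ∧ W ≤ outerSpace f r ∧ (∀ w ∈ W, f w ∈ W) ∧
      x ∈ W := by
  induction hx using Submodule.iSup_induction' with
  | mem μ x hx =>
    have key : ∀ k : ℕ, ∀ x, ((f - (μ : ℂ) • 1) ^ k) x = 0 →
        ∃ W : Submodule ℂ M, FiniteDimensional ℂ W ∧ W ≤ outerSpace f r ∧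
          (∀ w ∈ W, f w ∈ W) ∧ x ∈ W := by
      intro k
      induction k with
      | zero =>
        intro x hx
        have hx : x = 0 := by simpa using hx
        exact ⟨⊥, inferInstance, bot_le, by simp, by simp [hx]⟩
      | succ k ih =>
        intro x hx
        obtain ⟨W, hW, hWV, hWf, hxW⟩ := ih (f x - (μ : ℂ) • x) (by simpa [pow_succ] using hx)
        refine ⟨W ⊔ ℂ ∙ x, inferInstance, sup_le hWV ?_, ?_, ?_⟩
        · rw [Submodule.span_singleton_le_iff_mem]
          exact maxGenEigenspace_le_outerSpace f μ.2
            ((mem_maxGenEigenspace f _ x).2 ⟨k + 1, hx⟩)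
        · intro w hw
          obtain ⟨y, hy, z, hz, rfl⟩ := Submodule.mem_sup.1 hw
          obtain ⟨a, rfl⟩ := Submodule.mem_span_singleton.1 hz
          have : f (y + a • x) = (f y + a • (f x - (μ : ℂ) • x)) + (a * μ) • x := by
            rw [map_add, map_smul]; module
          rw [this]
          exact Submodule.add_mem_sup (add_mem (hWf _ hy) (Submodule.smul_mem _ _ hxW))
            (Submodule.smul_mem _ _ (Submodule.mem_span_singleton_self x))
        · exact Submodule.mem_sup_right (Submodule.mem_span_singleton_self x)
    obtain ⟨k, hk⟩ := (mem_maxGenEigenspace f _ x).1 hx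
    exact key k x hk
  | zero => exact ⟨⊥, inferInstance, bot_le, by simp, by simp⟩
  | add x y _ _ hx hy =>
    obtain ⟨W, h1, h2, h3, h4⟩ := hx
    obtain ⟨W', h1', h2', h3', h4'⟩ := hy
    refine ⟨W ⊔ W', inferInstance, sup_le h2 h2', ?_, Submodule.add_mem_sup h4 h4'⟩
    intro w hw
    obtain ⟨a, ha, b, hb, rfl⟩ := Submodule.mem_sup.1 hw
    rw [map_add]
    exact Submodule.add_mem_sup (h3 a ha) (h3' b hb)

lemma finiteDimensional_outerSpace (f : End ℂ M) (r : ℝ) (m : ℕ)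
    (h : ∀ W : Submodule ℂ M, FiniteDimensional ℂ W → W ≤ outerSpace f r →
      (∀ w ∈ W, f w ∈ W) → finrank ℂ W ≤ m) :
    FiniteDimensional ℂ (outerSpace f r) := by
  let P : ℕ → Prop := fun n => ∃ W : Submodule ℂ M, FiniteDimensional ℂ W ∧ W ≤ outerSpace f r ∧
    (∀ w ∈ W, f w ∈ W) ∧ finrank ℂ W = n
  have hP : P 0 := ⟨⊥, inferInstance, bot_le, by simp, by simp⟩
  classical
  obtain ⟨W, h1, h2, h3, h4⟩ := Nat.findGreatest_spec (P := P) (Nat.zero_le m) hP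
  suffices outerSpace f r ≤ W by
    exact Submodule.finiteDimensional_of_le this
  intro x hx
  obtain ⟨W', h1', h2', h3', h4'⟩ := exists_finiteDimensional_invariant f r hx
  have hinv : ∀ w ∈ W ⊔ W', f w ∈ W ⊔ W' := by
    intro w hw
    obtain ⟨a, ha, b, hb, rfl⟩ := Submodule.mem_sup.1 hw
    rw [map_add]
    exact Submodule.add_mem_sup (h3 a ha) (h3' b hb)
  have hle : finrank ℂ ↥(W ⊔ W') ≤ finrank ℂ W := by
    rw [h4]
    exact Nat.le_findGreatest (h _ inferInstance (sup_le h2 h2') hinv)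
      ⟨_, inferInstance, sup_le h2 h2', hinv, rfl⟩
  have := Submodule.eq_of_le_of_finrank_le (le_sup_left : W ≤ W ⊔ W') hle
  rw [this]
  exact Submodule.mem_sup_right h4'

lemma rootMultiplicity_charpoly_outerSpace (f : End ℂ M) (r : ℝ)
    [FiniteDimensional ℂ (outerSpace f r)] (μ : ℂ) :
    (f.restrict fun _ hx => map_mem_outerSpace f r hx :
      End ℂ (outerSpace f r)).charpoly.rootMultiplicity μ =
      if r < ‖μ‖ then finrank ℂ (f.maxGenEigenspace μ) else 0 := by
  rw [← LinearMap.finrank_maxGenEigenspace_eq, maxGenEigenspace,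
    genEigenspace_restrict]
  split_ifs with h
  · exact (Submodule.comapSubtypeEquivOfLe (maxGenEigenspace_le_outerSpace f h)).finrank_eq
  · rw [Submodule.finrank_eq_zero, ← Submodule.disjoint_iff_comap_eq_bot]
    exact (disjoint_maxGenEigenspace_outerSpace f h).symm

lemma algMult_eq {H : Type u} [NormedAddCommGroup H] [InnerProductSpace ℂ H]
    (A : H →L[ℂ] H) (z : ℂ) :
    algMult A z = Module.rank ℂ (maxGenEigenspace (A : H →ₗ[ℂ] H) z) := by
  have : maxGenEigenspace (A : H →ₗ[ℂ] H) z =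
      ⨆ ℓ : ℕ, LinearMap.ker (((A : H →ₗ[ℂ] H) - z • LinearMap.id) ^ ℓ) := by
    rw [maxGenEigenspace, genEigenspace_top]
    exact iSup_congr fun k => genEigenspace_nat
  rw [algMult, this]

end GenEigenspaces

section Multiplicities

open Module Module.End

variable {H : Type u} [NormedAddCommGroup H] [InnerProductSpace ℂ H]

lemma rank_maxGenEigenspace_mul_le (S T : End ℂ H) {z : ℂ} (hz : z ≠ 0) :
    Module.rank ℂ (maxGenEigenspace (S * T) z) ≤ Module.rank ℂ (maxGenEigenspace (T * S) z) := by
  have hpow : ∀ (k : ℕ) (x : H), ((T * S - z • 1) ^ k) (T x) = T (((S * T - z • 1) ^ k) x) := by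
    intro k
    induction k with
    | zero => intro x; rfl
    | succ k ih =>
      intro x
      have : (T * S - z • (1 : End ℂ H)) (T x) = T ((S * T - z • (1 : End ℂ H)) x) := by simp
      rw [pow_succ, pow_succ, Module.End.mul_apply, Module.End.mul_apply, this, ih]
  have hmap : ∀ x ∈ maxGenEigenspace (S * T) z, T x ∈ maxGenEigenspace (T * S) z := by
    intro x hx
    obtain ⟨k, hk⟩ := (mem_maxGenEigenspace _ _ x).1 hx
    exact (mem_maxGenEigenspace _ _ _).2 ⟨k, by rw [hpow, hk, map_zero]⟩
  refine LinearMap.rank_le_of_injective (T.restrict hmap) ?_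
  rw [← LinearMap.ker_eq_bot, LinearMap.ker_eq_bot']
  rintro ⟨x, hx⟩ h0
  have hT : T x = 0 := congrArg Subtype.val h0
  have h1 : x ∈ maxGenEigenspace (S * T) 0 :=
    (mem_maxGenEigenspace _ _ _).2 ⟨1, by simp [hT]⟩
  exact Subtype.ext (Submodule.disjoint_def.1 ((S * T).disjoint_genEigenspace hz _ _) x hx h1)

lemma algMult_mul_comm (S T : H →L[ℂ] H) {z : ℂ} (hz : z ≠ 0) :
    algMult (S * T) z = algMult (T * S) z := by
  rw [algMult_eq, algMult_eq]
  exact le_antisymm (rank_maxGenEigenspace_mul_le (S : End ℂ H) T hz)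
    (rank_maxGenEigenspace_mul_le (T : End ℂ H) S hz)

lemma IsEigenvalueSequence.mul_comm {S T : H →L[ℂ] H} {lam : ℕ → ℂ}
    (h : IsEigenvalueSequence (S * T) lam) : IsEigenvalueSequence (T * S) lam :=
  ⟨h.1, fun z hz => by rw [h.2 z hz, algMult_mul_comm S T hz]⟩

variable {A : H →L[ℂ] H} {lam : ℕ → ℂ}

lemma IsEigenvalueSequence.card_eq (h : IsEigenvalueSequence A lam) {r : ℝ} (hr : 0 ≤ r)
    [FiniteDimensional ℂ (outerSpace (A : End ℂ H) r)] {z : ℂ} (hz : r < ‖z‖) :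
    {j | lam j = z}.Finite ∧
      {j | lam j = z}.ncard = finrank ℂ (maxGenEigenspace (A : End ℂ H) z) := by
  have hz0 : z ≠ 0 := by
    rintro rfl; simp at hz; linarith
  have hle := maxGenEigenspace_le_outerSpace (A : End ℂ H) hz
  have : FiniteDimensional ℂ (maxGenEigenspace (A : End ℂ H) z) :=
    Submodule.finiteDimensional_of_le hle
  have h2 := h.2 z hz0
  rw [algMult_eq, ← finrank_eq_rank] at h2
  simp only [Cardinal.lift_uzero] at h2
  have h3 : Cardinal.mk {j : ℕ | lam j = z} =
      (finrank ℂ (maxGenEigenspace (A : End ℂ H) z) : ℕ) := by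
    have := h2
    rwa [← Cardinal.lift_natCast.{u, 0}, Cardinal.lift_inj] at this
  constructor
  · rw [← Set.finite_coe_iff, ← Cardinal.lt_aleph0_iff_finite, h3]
    exact Cardinal.natCast_lt_aleph0
  · rw [← Nat.card_coe_set_eq, Nat.card, h3, Cardinal.toNat_natCast]

/-- The terms of modulus larger than `r` of an eigenvalue sequence are, as a multiset, the roots of
the characteristic polynomial on the outer space. -/
lemma IsEigenvalueSequence.exists_finset (h : IsEigenvalueSequence A lam) {r : ℝ} (hr : 0 ≤ r)
    [FiniteDimensional ℂ (outerSpace (A : End ℂ H) r)] :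
    ∃ J : Finset ℕ, (∀ j, j ∈ J ↔ r < ‖lam j‖) ∧
      J.card = finrank ℂ (outerSpace (A : End ℂ H) r) ∧
      ∑ j ∈ J, lam j = LinearMap.trace ℂ _ ((A : End ℂ H).restrict
        (fun _ hx => map_mem_outerSpace (A : End ℂ H) r hx)) := by
  classical
  set g : End ℂ (outerSpace (A : End ℂ H) r) :=
    (A : End ℂ H).restrict (fun _ hx => map_mem_outerSpace (A : End ℂ H) r hx) with hg
  have hcount : ∀ z, g.charpoly.roots.count z =
      if r < ‖z‖ then finrank ℂ (maxGenEigenspace (A : End ℂ H) z) else 0 := fun z => by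
    rw [Polynomial.count_roots]
    exact rootMultiplicity_charpoly_outerSpace _ r z
  have hfin : {j | r < ‖lam j‖}.Finite := by
    have : {j | r < ‖lam j‖} ⊆ ⋃ z ∈ g.charpoly.roots.toFinset, {j | lam j = z ∧ r < ‖z‖} := by
      intro j (hj : r < ‖lam j‖)
      simp only [Set.mem_iUnion]
      refine ⟨lam j, ?_, rfl, hj⟩
      rw [Multiset.mem_toFinset, ← Multiset.count_pos, hcount, if_pos hj]
      obtain ⟨h1, h2⟩ := h.card_eq hr hj
      rw [← h2, Set.ncard_pos h1]
      exact ⟨j, rfl⟩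
    refine Set.Finite.subset (Set.Finite.biUnion (Finset.finite_toSet _) fun z _ => ?_) this
    by_cases hz : r < ‖z‖
    · exact (h.card_eq hr hz).1.subset fun j hj => hj.1
    · convert Set.finite_empty
      ext j; simp [hz]
  have hroots : hfin.toFinset.val.map lam = g.charpoly.roots := by
    ext z
    rw [hcount, Multiset.count_map]
    split_ifs with hz
    · rw [← (h.card_eq hr hz).2, ← Finset.filter_val, Finset.card_val,
        ← Set.ncard_coe_finset]
      congr 1
      ext j
      simp only [Finset.coe_filter, Set.Finite.mem_toFinset, Set.mem_ofPred_eq]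
      constructor
      · rintro ⟨_, rfl⟩; rfl
      · rintro rfl; exact ⟨hz, rfl⟩
    · rw [Multiset.card_eq_zero, Multiset.filter_eq_nil]
      intro j hj
      rintro rfl
      exact hz (by simpa using hj)
  refine ⟨hfin.toFinset, by simp, ?_, ?_⟩
  · rw [Finset.card_def, ← Multiset.card_map lam, hroots,
      IsAlgClosed.card_roots_eq_natDegree, LinearMap.charpoly_natDegree]
  · rw [Module.End.trace_eq_sum_roots_charpoly_of_splits (IsAlgClosed.splits _), ← hroots]
    rfl

end Multiplicities

section WeakDecay

open Module Module.End

open scoped InnerProductSpace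

/-- Hadamard's inequality for the columns of a complex matrix. -/
lemma norm_det_le_prod_norm_col {n : ℕ} (M : Matrix (Fin n) (Fin n) ℂ) :
    ‖M.det‖ ≤ ∏ j, ‖(WithLp.toLp 2 (fun i => M i j) : EuclideanSpace ℂ (Fin n))‖ := by
  set v : Fin n → EuclideanSpace ℂ (Fin n) := fun j => WithLp.toLp 2 (fun i => M i j)
  let e := EuclideanSpace.basisFun (Fin n) ℂ
  have hM : M.det = e.toBasis.det v := by
    rw [Basis.det_apply]
    congr 1
  have hdim : finrank ℂ (EuclideanSpace ℂ (Fin n)) = Fintype.card (Fin n) := by simp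
  let b := InnerProductSpace.gramSchmidtOrthonormalBasis hdim v
  have hb : b.toBasis.det v = ∏ i, ⟪b i, v i⟫_ℂ :=
    InnerProductSpace.gramSchmidtOrthonormalBasis_det hdim v
  have h1 : ‖e.toBasis.det b‖ = 1 := e.det_to_matrix_orthonormalBasis b
  have h2 : e.toBasis.det v = e.toBasis.det b * b.toBasis.det v := by
    rw [Basis.det_apply, Basis.det_apply, Basis.det_apply, ← Matrix.det_mul]
    congr 1
    have := e.toBasis.toMatrix_mul_toMatrix b.toBasis v
    rw [OrthonormalBasis.coe_toBasis] at this
    exact this.symm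
  rw [hM, h2, norm_mul, h1, one_mul, hb, norm_prod]
  refine Finset.prod_le_prod (fun _ _ => norm_nonneg _) fun i _ => ?_
  simpa using norm_inner_le_norm (𝕜 := ℂ) (b i) (v i)

variable {H : Type u} [NormedAddCommGroup H] [InnerProductSpace ℂ H]

/-- The operator `A` is of order `C / (j + 1)` off a subspace of dimension at most `j`, for
every `j`. -/
def WeakDecay (C : ℝ) (A : H →L[ℂ] H) : Prop :=
  ∀ j : ℕ, ∃ E : Submodule ℂ H, FiniteDimensional ℂ E ∧ finrank ℂ E ≤ j ∧
    ∀ x ∈ Eᗮ, ‖A x‖ ≤ C / (j + 1) * ‖x‖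

lemma WeakDecay.mono {C D : ℝ} {A : H →L[ℂ] H} (h : WeakDecay C A) (hCD : C ≤ D) :
    WeakDecay D A := fun j => by
  obtain ⟨E, h1, h2, h3⟩ := h j
  refine ⟨E, h1, h2, fun x hx => (h3 x hx).trans ?_⟩
  gcongr

lemma WeakDecay.comp_left {C : ℝ} {A : H →L[ℂ] H} (h : WeakDecay C A) (B : H →L[ℂ] H) :
    WeakDecay (‖B‖ * C) (B * A) := fun j => by
  obtain ⟨E, h1, h2, h3⟩ := h j
  refine ⟨E, h1, h2, fun x hx => ?_⟩
  calc ‖B (A x)‖ ≤ ‖B‖ * ‖A x‖ := B.le_opNorm _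
    _ ≤ ‖B‖ * (C / (j + 1) * ‖x‖) := by gcongr; exact h3 x hx
    _ = _ := by ring

lemma WeakDecay.smul {C : ℝ} {A : H →L[ℂ] H} (h : WeakDecay C A) (c : ℂ) :
    WeakDecay (‖c‖ * C) (c • A) := fun j => by
  obtain ⟨E, h1, h2, h3⟩ := h j
  refine ⟨E, h1, h2, fun x hx => ?_⟩
  calc ‖c • A x‖ = ‖c‖ * ‖A x‖ := norm_smul _ _
    _ ≤ ‖c‖ * (C / (j + 1) * ‖x‖) := by gcongr; exact h3 x hx
    _ = _ := by ring

lemma WeakDecay.add {C D : ℝ} {A B : H →L[ℂ] H} (hC : 0 ≤ C) (hD : 0 ≤ D) (hA : WeakDecay C A)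
    (hB : WeakDecay D B) : WeakDecay (2 * (C + D)) (A + B) := fun j => by
  obtain ⟨E, h1, h2, h3⟩ := hA (j / 2)
  obtain ⟨F, h1', h2', h3'⟩ := hB (j / 2)
  refine ⟨E ⊔ F, inferInstance, ?_, fun x hx => ?_⟩
  · have := Submodule.finrank_add_le_finrank_add_finrank E F
    omega
  · have hE : x ∈ Eᗮ := Submodule.orthogonal_le le_sup_left hx
    have hF : x ∈ Fᗮ := Submodule.orthogonal_le le_sup_right hx
    have hj : ((j : ℝ) + 1) / 2 ≤ ((j / 2 : ℕ) : ℝ) + 1 := by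
      have : j + 1 ≤ 2 * (j / 2 + 1) := by omega
      have : (j : ℝ) + 1 ≤ 2 * (((j / 2 : ℕ) : ℝ) + 1) := by exact_mod_cast this
      linarith
    calc ‖A x + B x‖ ≤ ‖A x‖ + ‖B x‖ := norm_add_le _ _
      _ ≤ C / (((j : ℝ) + 1) / 2) * ‖x‖ + D / (((j : ℝ) + 1) / 2) * ‖x‖ := by
        refine add_le_add ((h3 x hE).trans ?_) ((h3' x hF).trans ?_) <;> gcongr
      _ = _ := by field_simp

lemma MemWeak.exists_weakDecay {A : H →L[ℂ] H} (h : MemWeak 1 A) :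
    ∃ C, 0 < C ∧ WeakDecay C A := by
  obtain ⟨-, C, hC⟩ := h
  refine ⟨max (max C 0 + 1) ‖A‖, lt_max_of_lt_left (by positivity), fun j => ?_⟩
  rcases Nat.eq_zero_or_pos j with rfl | hj
  · refine ⟨⊥, inferInstance, by simp, fun x _ => (A.le_opNorm x).trans ?_⟩
    gcongr
    simp
  by_cases hne : Nonempty {E : Submodule ℂ H // finrank ℂ E = j}
  · have h1 : sv A j ≤ C / (j + 1) := by
      rw [le_div_iff₀' (by positivity)]
      simpa using hC j
    have h2 : sv A j < (max C 0 + 1) / (j + 1) :=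
      h1.trans_lt (by gcongr; exact (le_max_left C 0).trans_lt (lt_add_one _))
    obtain ⟨⟨E, hE⟩, hEl⟩ := exists_lt_of_ciInf_lt h2
    refine ⟨E, FiniteDimensional.of_finrank_pos (by omega), hE.le, fun x hx => ?_⟩
    rcases eq_or_ne x 0 with rfl | hx0
    · simp
    have hx0' : ‖x‖ ≠ 0 := norm_ne_zero_iff.2 hx0
    have hbdd : BddAbove (Set.range fun ξ : {ξ : H // ξ ∈ Eᗮ ∧ ‖ξ‖ = 1} => ‖A ξ.1‖) := by
      refine ⟨‖A‖, ?_⟩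
      rintro _ ⟨ξ, rfl⟩
      simpa [ξ.2.2] using A.le_opNorm ξ.1
    have hu : ‖((‖x‖⁻¹ : ℝ) : ℂ) • x‖ = 1 := by
      rw [norm_smul]; simp [hx0']
    have h3 := (le_ciSup hbdd ⟨((‖x‖⁻¹ : ℝ) : ℂ) • x, Submodule.smul_mem _ _ hx, hu⟩).trans hEl.le
    simp only [map_smul, norm_smul] at h3
    rw [Complex.norm_real, norm_inv, norm_norm, inv_mul_le_iff₀ (by positivity), mul_comm] at h3
    refine h3.trans ?_
    gcongr
    exact le_max_left _ _
  · have hfin : ¬ (j : Cardinal) ≤ Module.rank ℂ H := by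
      intro hle
      obtain ⟨s, hs, hli⟩ := exists_finset_linearIndependent_of_le_rank hle
      exact hne ⟨⟨Submodule.span ℂ s, by rw [finrank_span_finset_eq_card hli, hs]⟩⟩
    have hlt := not_le.1 hfin
    have : FiniteDimensional ℂ H :=
      Module.rank_lt_aleph0_iff.1 (hlt.trans Cardinal.natCast_lt_aleph0)
    refine ⟨⊤, inferInstance, ?_, fun x hx => ?_⟩
    · rw [finrank_top]
      rw [← finrank_eq_rank] at hlt
      exact_mod_cast hlt.le
    · have : x = 0 := by simpa using hx
      simp [this]

/-- Every finite-dimensional subspace has an orthonormal basis adapted to the decay of `A`. -/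
lemma WeakDecay.exists_orthonormal {C : ℝ} {A : H →L[ℂ] H} (h : WeakDecay C A) (n : ℕ) :
    ∀ F : Submodule ℂ H, FiniteDimensional ℂ F → n ≤ finrank ℂ F →
      ∃ v : Fin n → H, Orthonormal ℂ v ∧ (∀ i, v i ∈ F) ∧ ∀ i, ‖A (v i)‖ ≤ C / ((i : ℕ) + 1) := by
  induction n with
  | zero => exact fun F _ _ => ⟨Fin.elim0, ⟨fun i => i.elim0, fun i => i.elim0⟩, fun i => i.elim0,
      fun i => i.elim0⟩
  | succ n ih =>
    intro F hF hn
    obtain ⟨E, hE, hEn, hEA⟩ := h n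
    have key : ∀ E : Submodule ℂ H, FiniteDimensional ℂ E →
        finrank ℂ F ≤ finrank ℂ ↥(F ⊓ Eᗮ) + finrank ℂ E := by
      intro E hE
      let g : F →ₗ[ℂ] E := (E.orthogonalProjectionOnto : H →ₗ[ℂ] E).comp F.subtype
      have h1 := g.finrank_range_add_finrank_ker
      have h2 : finrank ℂ (LinearMap.range g) ≤ finrank ℂ E := Submodule.finrank_le _
      have h3 : finrank ℂ (LinearMap.ker g) = finrank ℂ ↥(F ⊓ Eᗮ) := by
        have : LinearMap.ker g = Submodule.comap F.subtype Eᗮ := by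
          ext x
          simp [g]
        rw [this, ← Submodule.finrank_map_subtype_eq, Submodule.map_comap_subtype]
      omega
    have hpos : 0 < finrank ℂ ↥(F ⊓ Eᗮ) := by have := key E hE; omega
    obtain ⟨⟨x, hxF, hxE⟩, hx0⟩ := Module.finrank_pos_iff_exists_ne_zero.1 hpos
    have hx0 : x ≠ 0 := fun h => hx0 (Subtype.ext h)
    set u : H := ((‖x‖⁻¹ : ℝ) : ℂ) • x
    have hu : ‖u‖ = 1 := by
      rw [norm_smul]; simp [norm_ne_zero_iff.2 hx0]
    have huF : u ∈ F := Submodule.smul_mem _ _ hxF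
    have huE : u ∈ Eᗮ := Submodule.smul_mem _ _ hxE
    have hn' : n ≤ finrank ℂ ↥(F ⊓ (ℂ ∙ u)ᗮ) := by
      have := key (ℂ ∙ u) inferInstance
      have := finrank_span_singleton (K := ℂ) (v := u) (by rintro h0; simp [h0] at hu)
      omega
    obtain ⟨v, hv, hvF, hvA⟩ := ih _ inferInstance hn'
    have huv : ∀ i, ⟪u, v i⟫_ℂ = 0 := fun i =>
      Submodule.mem_orthogonal_singleton_iff_inner_right.1 (hvF i).2
    refine ⟨Fin.snoc v u, ⟨?_, ?_⟩, ?_, ?_⟩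
    · intro i
      refine Fin.lastCases ?_ (fun i => ?_) i
      · simpa using hu
      · simpa using hv.1 i
    · intro i j
      refine Fin.lastCases ?_ (fun i => ?_) i <;> refine Fin.lastCases ?_ (fun j => ?_) j
      · simp
      · intro _; simpa using huv j
      · intro _; simpa using inner_eq_zero_symm.1 (huv i)
      · intro hij
        simpa using hv.2 (fun h => hij (by rw [h]))
    · intro i
      refine Fin.lastCases ?_ (fun i => ?_) i
      · simpa using huF
      · simpa using (hvF i).1
    · intro i
      refine Fin.lastCases ?_ (fun i => ?_) i
      · simpa [hu] using hEA u huE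
      · simpa using hvA i

lemma WeakDecay.exists_orthonormalBasis {C : ℝ} {A : H →L[ℂ] H} (h : WeakDecay C A)
    (F : Submodule ℂ H) [FiniteDimensional ℂ F] {n : ℕ} (hn : finrank ℂ F = n) :
    ∃ b : OrthonormalBasis (Fin n) ℂ F, ∀ i, ‖A (b i)‖ ≤ C / ((i : ℕ) + 1) := by
  subst hn
  obtain ⟨v, hv, hvF, hvA⟩ := h.exists_orthonormal _ F inferInstance le_rfl
  have hw : Orthonormal ℂ (fun i => (⟨v i, hvF i⟩ : F)) := by
    rw [← F.subtypeₗᵢ.orthonormal_comp_iff]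
    exact hv
  have hspan := (hw.linearIndependent.span_eq_top_of_card_eq_finrank' (by simp)).ge
  exact ⟨OrthonormalBasis.mk hw hspan, fun i => by simpa using hvA i⟩

lemma pow_card_le_norm_multiset_prod {r : ℝ} (hr : 0 ≤ r) (s : Multiset ℂ)
    (hs : ∀ z ∈ s, r ≤ ‖z‖) : r ^ Multiset.card s ≤ ‖s.prod‖ := by
  induction s using Multiset.induction with
  | empty => simp
  | cons a s ih =>
    rw [Multiset.card_cons, Multiset.prod_cons, norm_mul, pow_succ']
    exact mul_le_mul (hs a (Multiset.mem_cons_self a s))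
      (ih fun z hz => hs z (Multiset.mem_cons_of_mem hz)) (by positivity) (norm_nonneg _)

/-- Weyl's inequality for the dimension of invariant subspaces. -/
lemma WeakDecay.finrank_mul_le {C : ℝ} {A : H →L[ℂ] H} (h : WeakDecay C A) (hC : 0 < C) {r : ℝ}
    (hr : 0 < r) (W : Submodule ℂ H) [FiniteDimensional ℂ W] (hW : ∀ w ∈ W, A w ∈ W)
    (hWr : W ≤ outerSpace (A : End ℂ H) r) :
    finrank ℂ W * r ≤ C * Real.exp 1 := by
  set n := finrank ℂ W with hn
  obtain ⟨b, hb⟩ := h.exists_orthonormalBasis W hn.symm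
  rcases Nat.eq_zero_or_pos n with h0 | hpos
  · rw [h0]; simp; positivity
  set g : End ℂ W := (A : End ℂ H).restrict hW
  have hdet : ‖LinearMap.det g‖ ≤ ∏ j : Fin n, C / ((j : ℕ) + 1) := by
    rw [← LinearMap.det_toMatrix b.toBasis]
    refine (norm_det_le_prod_norm_col _).trans ?_
    refine Finset.prod_le_prod (fun _ _ => norm_nonneg _) fun j _ => ?_
    have : (WithLp.toLp 2 fun i => LinearMap.toMatrix b.toBasis b.toBasis g i j) =
        b.repr (g (b j)) := by
      ext i
      simp [LinearMap.toMatrix_apply]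
    rw [this, LinearIsometryEquiv.norm_map]
    exact hb j
  have hlow : r ^ n ≤ ‖LinearMap.det g‖ := by
    rw [Module.End.det_eq_prod_roots_charpoly_of_splits (IsAlgClosed.splits _)]
    have hcard : Multiset.card (LinearMap.charpoly g).roots = n := by
      rw [IsAlgClosed.card_roots_eq_natDegree, LinearMap.charpoly_natDegree]
    rw [← hcard]
    refine pow_card_le_norm_multiset_prod hr.le _ fun z hz => ?_
    have hz' : g.HasEigenvalue z := by
      rw [Module.End.hasEigenvalue_iff_isRoot_charpoly]
      exact Polynomial.isRoot_of_mem_roots hz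
    obtain ⟨x, hx⟩ := hz'.exists_hasEigenvector
    refine (lt_norm_of_mem_outerSpace (A : End ℂ H) (hWr x.2) (fun h0 => hx.2 (Subtype.ext h0))
      ?_).le
    exact congrArg Subtype.val hx.apply_eq_smul
  have hprod : ∏ j : Fin n, C / (((j : ℕ) : ℝ) + 1) = C ^ n / n.factorial := by
    rw [Fin.prod_univ_eq_prod_range (fun j => C / ((j : ℝ) + 1)), Finset.prod_div_distrib,
      Finset.prod_const, Finset.card_range, ← Finset.prod_range_add_one_eq_factorial]
    push_cast
    rfl
  have hexp := Real.pow_div_factorial_le_exp (n : ℝ) (Nat.cast_nonneg n) n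
  refine (pow_le_pow_iff_left₀ (by positivity) (by positivity) hpos.ne').1 ?_
  calc ((n : ℝ) * r) ^ n = (n : ℝ) ^ n * r ^ n := mul_pow _ _ _
    _ ≤ (n : ℝ) ^ n * (C ^ n / n.factorial) := by
      gcongr; exact (hlow.trans hdet).trans hprod.le
    _ = C ^ n * ((n : ℝ) ^ n / n.factorial) := by ring
    _ ≤ C ^ n * Real.exp n := by gcongr
    _ = (C * Real.exp 1) ^ n := by rw [mul_pow, ← Real.exp_nat_mul, mul_one]

lemma WeakDecay.finiteDimensional_outerSpace {C : ℝ} {A : H →L[ℂ] H} (h : WeakDecay C A)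
    (hC : 0 < C) {r : ℝ} (hr : 0 < r) : FiniteDimensional ℂ (outerSpace (A : End ℂ H) r) := by
  refine _root_.finiteDimensional_outerSpace _ r ⌊C * Real.exp 1 / r⌋₊ fun W hW hWr hWA => ?_
  exact Nat.le_floor ((le_div_iff₀ hr).2 (h.finrank_mul_le hC hr W hWA hWr))

lemma IsEigenvalueSequence.antitone {A : H →L[ℂ] H} {lam : ℕ → ℂ}
    (hlam : IsEigenvalueSequence A lam) : Antitone fun j => ‖lam j‖ :=
  antitone_nat_of_succ_le hlam.1

/-- Weyl's inequality: the eigenvalues of `A` decay like `1 / (j + 1)`. -/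
lemma WeakDecay.norm_eigenvalue_le {C : ℝ} {A : H →L[ℂ] H} (h : WeakDecay C A) (hC : 0 < C)
    {lam : ℕ → ℂ} (hlam : IsEigenvalueSequence A lam) (j : ℕ) :
    ‖lam j‖ ≤ C * Real.exp 1 / (j + 1) := by
  refine le_of_forall_lt fun r hr => ?_
  rcases le_or_gt r 0 with h0 | h0
  · exact h0.trans_lt (by positivity)
  obtain ⟨s, hs, hs'⟩ := exists_between hr
  have hs0 := h0.trans hs
  have := h.finiteDimensional_outerSpace hC hs0
  obtain ⟨J, hJ, hJc, -⟩ := hlam.exists_finset hs0.le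
  have h1 : Finset.range (j + 1) ⊆ J := fun i hi =>
    (hJ i).2 (hs'.trans_le (hlam.antitone (Nat.lt_succ_iff.1 (Finset.mem_range.1 hi))))
  have h2 : j + 1 ≤ finrank ℂ (outerSpace (A : End ℂ H) s) := by
    rw [← hJc]; simpa using Finset.card_le_card h1
  have h3 := h.finrank_mul_le hC hs0 (outerSpace (A : End ℂ H) s)
    (fun _ hx => map_mem_outerSpace (A : End ℂ H) s hx) le_rfl
  rw [lt_div_iff₀' (by positivity)]
  have h4 : ((j : ℝ) + 1) ≤ finrank ℂ (outerSpace (A : End ℂ H) s) := by exact_mod_cast h2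
  calc ((j : ℝ) + 1) * r < (j + 1) * s := by gcongr
    _ ≤ finrank ℂ (outerSpace (A : End ℂ H) s) * s := by gcongr
    _ ≤ _ := h3

end WeakDecay

section ComplexAnalysis

open Metric

/-- A zero-free holomorphic function with value `1` at the center of a disc and a bound on its
modulus has a bounded logarithmic derivative there. -/
lemma norm_deriv_zero_le_of_norm_le_exp {f : ℂ → ℂ} {ρ M : ℝ} (hρ : 0 < ρ) (hM : 0 < M)
    (hf : DifferentiableOn ℂ f (ball 0 ρ)) (hf0 : ∀ z ∈ ball 0 ρ, f z ≠ 0) (h1 : f 0 = 1)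
    (hfM : ∀ z ∈ ball 0 ρ, ‖f z‖ ≤ Real.exp M) : ‖deriv f 0‖ ≤ 4 * M / ρ := by
  have h0 : (0 : ℂ) ∈ ball (0 : ℂ) ρ := mem_ball_self hρ
  have hnhds : ∀ z ∈ ball (0 : ℂ) ρ, HasDerivAt f (deriv f z) z := fun z hz =>
    (hf.differentiableAt (isOpen_ball.mem_nhds hz)).hasDerivAt
  have hquot : DifferentiableOn ℂ (fun z => deriv f z / f z) (ball 0 ρ) :=
    (hf.deriv isOpen_ball).div hf hf0
  obtain ⟨g, hg0, hg⟩ := hquot.isExactOn_ball.with_val_at 0 0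
  have hgd : DifferentiableOn ℂ g (ball 0 ρ) := fun z hz =>
    (hg z hz).differentiableAt.differentiableWithinAt
  have hder : ∀ z ∈ ball (0 : ℂ) ρ, HasDerivAt (fun w => f w * Complex.exp (-g w)) 0 z := by
    intro z hz
    refine ((hnhds z hz).mul ((hg z hz).fun_neg.cexp)).congr_deriv ?_
    have := hf0 z hz
    field_simp
    ring
  have hexp : ∀ z ∈ ball (0 : ℂ) ρ, f z = Complex.exp (g z) := by
    intro z hz
    have := isOpen_ball.is_const_of_deriv_eq_zero (convex_ball (0 : ℂ) ρ).isPreconnected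
      (fun w hw => (hder w hw).differentiableAt.differentiableWithinAt)
      (fun w hw => (hder w hw).deriv) hz h0
    simp only [hg0, h1, neg_zero, Complex.exp_zero, mul_one] at this
    rwa [Complex.exp_neg, mul_inv_eq_one₀ (Complex.exp_ne_zero _)] at this
  have hmaps : Set.MapsTo g (ball 0 ρ) {z | z.re ≤ M} := by
    intro z hz
    have := hfM z hz
    rwa [hexp z hz, Complex.norm_exp, Real.exp_le_exp] at this
  have hsub : closedBall (0 : ℂ) (ρ / 2) ⊆ ball 0 ρ := closedBall_subset_ball (by linarith)
  have hderiv : deriv f 0 = deriv g 0 := by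
    rw [(hg 0 h0).deriv, h1, div_one]
  rw [hderiv]
  have hbound : ∀ z ∈ sphere (0 : ℂ) (ρ / 2), ‖g z‖ ≤ 2 * M := by
    intro z hz
    have hz' := hsub (sphere_subset_closedBall hz)
    have := Complex.borelCaratheodory_zero hM hgd hmaps hρ hz' hg0
    rw [mem_sphere_zero_iff_norm.1 hz] at this
    refine this.trans_eq ?_
    field_simp
    ring
  have := Complex.norm_deriv_le_of_forall_mem_sphere_norm_le (half_pos hρ)
    (DifferentiableOn.diffContOnCl (hgd.mono (closure_ball_subset_closedBall.trans hsub))) hbound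
  refine this.trans_eq ?_
  field_simp
  ring

lemma hasDerivAt_det_of_eq_one {n : ℕ} {M : ℂ → Matrix (Fin n) (Fin n) ℂ}
    {M' : Matrix (Fin n) (Fin n) ℂ} {z : ℂ} (h1 : M z = 1)
    (hM : ∀ i j, HasDerivAt (fun w => M w i j) (M' i j) z) :
    HasDerivAt (fun w => (M w).det) M'.trace z := by
  simp only [Matrix.det_apply']
  have h := HasDerivAt.fun_sum (u := Finset.univ) fun (σ : Equiv.Perm (Fin n)) _ =>
    (HasDerivAt.fun_finsetProd (u := Finset.univ) fun i _ => hM (σ i) i).const_mul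
      ((Equiv.Perm.sign σ : ℤ) : ℂ)
  refine h.congr_deriv ?_
  rw [Finset.sum_eq_single 1]
  · simp only [Equiv.Perm.sign_one, Units.val_one, Int.cast_one, one_mul, Equiv.Perm.coe_one,
      id_eq, h1, Matrix.one_apply_eq, Finset.prod_const_one, one_smul]
    rfl
  · intro σ _ hσ
    refine mul_eq_zero_of_right _ (Finset.sum_eq_zero fun i _ => ?_)
    obtain ⟨j, hj, hji⟩ : ∃ j, σ j ≠ j ∧ j ≠ i := by
      by_contra! hcon
      refine hσ (Equiv.ext fun j => ?_)
      by_contra hj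
      have hji := hcon j hj
      subst hji
      exact hj (σ.injective (by_contra fun h => hj (hcon _ h)))
    rw [Finset.prod_eq_zero (Finset.mem_erase.2 ⟨hji, Finset.mem_univ j⟩), zero_smul]
    rw [h1, Matrix.one_apply_ne hj]
  · simp

end ComplexAnalysis

section TraceEstimate

open Module Module.End Metric

open scoped InnerProductSpace

lemma prod_one_add_div_le (N n : ℕ) :
    ∏ j : Fin n, (1 + (N : ℝ) / ((j : ℕ) + 1)) ≤ 2 ^ (N + n) := by
  have h : ∏ j : Fin n, (1 + (N : ℝ) / ((j : ℕ) + 1)) = (N + n).choose n := by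
    rw [Fin.prod_univ_eq_prod_range (fun j => 1 + (N : ℝ) / ((j : ℝ) + 1))]
    induction n with
    | zero => simp
    | succ n ih =>
      rw [Finset.prod_range_succ, ih]
      have := Nat.add_one_mul_choose_eq (N + n) n
      have h2 : ((N : ℝ) + n + 1) * (N + n).choose n = (N + (n + 1)).choose (n + 1) * (n + 1) := by
        rw [← add_assoc]
        exact_mod_cast this
      field_simp
      linarith
  rw [h]
  exact_mod_cast Nat.choose_le_two_pow _ _

variable {H : Type u} [NormedAddCommGroup H] [InnerProductSpace ℂ H]

/-- A perturbation determinant argument: if `R + ∑ i, ⟪w i, ·⟫ u i` has no eigenvalue of modulus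
greater than `2 * C / N`, then the trace of the finite rank part is controlled. -/
lemma norm_sum_inner_le_of_forall_eq_zero [CompleteSpace H] {n N : ℕ} {C : ℝ} (hC : 0 < C)
    (hN : 0 < N) (hn : n ≤ 2 * N) (R : H →L[ℂ] H) (hR : ‖R‖ ≤ C / N) (u w : Fin n → H)
    (hu : ∀ j, ‖u j‖ ≤ C / ((j : ℕ) + 1)) (hw : ∀ x, ∑ i, ‖⟪w i, x⟫_ℂ‖ ^ 2 ≤ ‖x‖ ^ 2)
    (hker : ∀ z : ℂ, ‖z‖ < N / (2 * C) →
      ∀ η, η = z • (R η + ∑ j, ⟪w j, η⟫_ℂ • u j) → η = 0) :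
    ‖∑ i, ⟪w i, u i⟫_ℂ‖ ≤ 8 * Real.log 8 * C := by
  have hN' : (0 : ℝ) < N := by exact_mod_cast hN
  set ρ : ℝ := N / (2 * C) with hρ
  have hρ0 : 0 < ρ := by positivity
  have hzR : ∀ z ∈ ball (0 : ℂ) ρ, ‖z • R‖ ≤ 1 / 2 := by
    intro z hz
    rw [mem_ball_zero_iff] at hz
    calc ‖z • R‖ = ‖z‖ * ‖R‖ := norm_smul _ _
      _ ≤ ρ * (C / N) := by gcongr
      _ = 1 / 2 := by rw [hρ]; field_simp
  have hunit : ∀ z ∈ ball (0 : ℂ) ρ, IsUnit (1 - z • R) := fun z hz =>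
    isUnit_one_sub_of_norm_lt_one ((hzR z hz).trans_lt (by norm_num))
  set G : ℂ → H →L[ℂ] H := fun z => Ring.inverse (1 - z • R) with hG
  have hGmul : ∀ z ∈ ball (0 : ℂ) ρ, ∀ x, G z x - z • R (G z x) = x := by
    intro z hz x
    have := congrArg (fun T : H →L[ℂ] H => T x) (Ring.mul_inverse_cancel _ (hunit z hz))
    simpa using this
  have hGnorm : ∀ z ∈ ball (0 : ℂ) ρ, ∀ x, ‖G z x‖ ≤ 2 * ‖x‖ := by
    intro z hz x
    have h1 : ‖z • R (G z x)‖ ≤ 1 / 2 * ‖G z x‖ :=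
      ((z • R).le_opNorm (G z x)).trans (by gcongr; exact hzR z hz)
    have h2 := norm_sub_norm_le (G z x) (z • R (G z x))
    rw [hGmul z hz x] at h2
    linarith
  have hGdiff : ∀ z ∈ ball (0 : ℂ) ρ, DifferentiableAt ℂ G z := by
    intro z hz
    have h1 : DifferentiableAt ℂ (fun z : ℂ => 1 - z • R) z := by fun_prop
    exact (differentiableAt_inverse (hunit z hz)).comp z h1
  have hentry : ∀ i j, ∀ z ∈ ball (0 : ℂ) ρ,
      DifferentiableAt ℂ (fun z => ⟪w i, G z (u j)⟫_ℂ) z := by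
    intro i j z hz
    have h1 : DifferentiableAt ℂ (fun z => G z (u j)) z :=
      (hGdiff z hz).clm_apply (differentiableAt_const _)
    exact (innerSL ℂ (w i)).differentiableAt.comp z h1
  set M : ℂ → Matrix (Fin n) (Fin n) ℂ := fun z =>
    Matrix.of fun i j => (1 : Matrix (Fin n) (Fin n) ℂ) i j - z * ⟪w i, G z (u j)⟫_ℂ with hM
  have h0mem : (0 : ℂ) ∈ ball (0 : ℂ) ρ := mem_ball_self hρ0
  have hM0 : M 0 = 1 := by ext i j; simp [hM]
  have hdet : HasDerivAt (fun z => (M z).det)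
      (Matrix.trace (Matrix.of fun i j => -⟪w i, u j⟫_ℂ)) 0 := by
    refine hasDerivAt_det_of_eq_one hM0 fun i j => ?_
    have h1 := ((hasDerivAt_id (0 : ℂ)).mul (hentry i j 0 h0mem).hasDerivAt).const_sub
      ((1 : Matrix (Fin n) (Fin n) ℂ) i j)
    refine h1.congr_deriv ?_
    simp [hG]
  have hdiff : DifferentiableOn ℂ (fun z => (M z).det) (ball 0 ρ) := by
    intro z hz
    refine DifferentiableAt.differentiableWithinAt ?_
    simp only [Matrix.det_apply', hM, Matrix.of_apply]
    refine DifferentiableAt.fun_sum fun σ _ => DifferentiableAt.const_mul ?_ _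
    refine DifferentiableAt.fun_finsetProd fun i _ => ?_
    exact (differentiableAt_const _).sub (differentiableAt_id.mul (hentry _ _ z hz))
  have hne : ∀ z ∈ ball (0 : ℂ) ρ, (M z).det ≠ 0 := by
    intro z hz hzero
    obtain ⟨c, hc0, hc⟩ := Matrix.exists_mulVec_eq_zero_iff.2 hzero
    set η : H := z • G z (∑ j, c j • u j) with hη
    have hci : ∀ i, c i = ⟪w i, η⟫_ℂ := by
      intro i
      have h1 := congrFun hc i
      simp only [Matrix.mulVec, dotProduct, hM, Matrix.of_apply, sub_mul, Finset.sum_sub_distrib,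
        Pi.zero_apply, Matrix.one_apply, ite_mul, one_mul, zero_mul, Finset.sum_ite_eq,
        Finset.mem_univ, if_true, sub_eq_zero] at h1
      rw [h1, hη, inner_smul_right, map_sum, inner_sum, Finset.mul_sum]
      refine Finset.sum_congr rfl fun j _ => ?_
      rw [map_smul, inner_smul_right]
      ring
    have hη0 : η = 0 := by
      refine hker z (mem_ball_zero_iff.1 hz) η ?_
      have h1 := hGmul z hz (∑ j, c j • u j)
      simp only [← hci]
      rw [← h1, smul_add, smul_sub, hη, map_smul]
      abel
    exact hc0 (funext fun i => by rw [hci i, hη0, inner_zero_right, Pi.zero_apply])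
  have hcol : ∀ z ∈ ball (0 : ℂ) ρ, ∀ j,
      ‖(WithLp.toLp 2 (fun i => M z i j) : EuclideanSpace ℂ (Fin n))‖ ≤
        1 + (N : ℝ) / ((j : ℕ) + 1) := by
    intro z hz j
    have h1 : (WithLp.toLp 2 (fun i => M z i j) : EuclideanSpace ℂ (Fin n)) =
        EuclideanSpace.single j 1 - z • WithLp.toLp 2 (fun i => ⟪w i, G z (u j)⟫_ℂ) := by
      ext i
      simp [hM, Matrix.one_apply]
    have h2 : ‖(WithLp.toLp 2 (fun i => ⟪w i, G z (u j)⟫_ℂ) : EuclideanSpace ℂ (Fin n))‖ ≤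
        ‖G z (u j)‖ := by
      rw [EuclideanSpace.norm_eq]
      exact Real.sqrt_le_iff.2 ⟨norm_nonneg _, hw _⟩
    rw [h1]
    refine (norm_sub_le _ _).trans ?_
    rw [norm_smul]
    have h3 : ‖(EuclideanSpace.single j (1 : ℂ) : EuclideanSpace ℂ (Fin n))‖ = 1 := by simp
    rw [h3]
    gcongr
    calc _ ≤ ρ * (2 * (C / ((j : ℕ) + 1))) := by
          gcongr
          · exact (mem_ball_zero_iff.1 hz).le
          · exact h2.trans ((hGnorm z hz _).trans (by gcongr; exact hu j))
      _ = _ := by rw [hρ]; field_simp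
  have hbound : ∀ z ∈ ball (0 : ℂ) ρ, ‖(M z).det‖ ≤ Real.exp (N * Real.log 8) := by
    intro z hz
    calc ‖(M z).det‖ ≤ _ := norm_det_le_prod_norm_col _
      _ ≤ ∏ j : Fin n, (1 + (N : ℝ) / ((j : ℕ) + 1)) :=
        Finset.prod_le_prod (fun _ _ => norm_nonneg _) fun j _ => hcol z hz j
      _ ≤ 2 ^ (N + n) := prod_one_add_div_le N n
      _ ≤ 2 ^ (3 * N) := pow_le_pow_right₀ (by norm_num) (by omega)
      _ = Real.exp (N * Real.log 8) := by
        rw [Real.exp_nat_mul, Real.exp_log (by norm_num), pow_mul]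
        norm_num
  have hfin := norm_deriv_zero_le_of_norm_le_exp hρ0
    (mul_pos hN' (Real.log_pos (by norm_num : (1 : ℝ) < 8))) hdiff hne (by rw [hM0, Matrix.det_one])
    hbound
  rw [hdet.deriv] at hfin
  simp only [Matrix.trace, Matrix.diag, Matrix.of_apply, Finset.sum_neg_distrib, norm_neg] at hfin
  refine hfin.trans_eq ?_
  rw [hρ]
  field_simp
  ring

/-- The trace of the compression of `A` to `F`. -/
noncomputable def compressionTrace (F : Submodule ℂ H) [FiniteDimensional ℂ F] (A : H →L[ℂ] H) :
    ℂ :=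
  LinearMap.trace ℂ F ((F.orthogonalProjectionOnto : H →ₗ[ℂ] F) ∘ₗ (A : H →ₗ[ℂ] H) ∘ₗ F.subtype)

lemma compressionTrace_eq_sum {F : Submodule ℂ H} [FiniteDimensional ℂ F] {ι : Type*} [Fintype ι]
    (b : OrthonormalBasis ι ℂ F) (A : H →L[ℂ] H) :
    compressionTrace F A = ∑ i, ⟪(b i : H), A (b i)⟫_ℂ := by
  rw [compressionTrace, LinearMap.trace_eq_sum_inner _ b]
  refine Finset.sum_congr rfl fun i _ => ?_
  simp

lemma compressionTrace_add (F : Submodule ℂ H) [FiniteDimensional ℂ F] (A B : H →L[ℂ] H) :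
    compressionTrace F (A + B) = compressionTrace F A + compressionTrace F B := by
  simp [compressionTrace_eq_sum (stdOrthonormalBasis ℂ F), Finset.sum_add_distrib]

lemma compressionTrace_smul (F : Submodule ℂ H) [FiniteDimensional ℂ F] (c : ℂ) (A : H →L[ℂ] H) :
    compressionTrace F (c • A) = c * compressionTrace F A := by
  simp [compressionTrace_eq_sum (stdOrthonormalBasis ℂ F), Finset.mul_sum]

end TraceEstimate

section TraceComparison

open Module Module.End Metric

open scoped InnerProductSpace

variable {H : Type u} [NormedAddCommGroup H] [InnerProductSpace ℂ H]

lemma starProjection_apply_eq_sum {F : Submodule ℂ H} [F.HasOrthogonalProjection] {ι : Type*}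
    [Fintype ι] (b : OrthonormalBasis ι ℂ F) (x : H) :
    F.starProjection x = ∑ i, ⟪(b i : H), x⟫_ℂ • (b i : H) := by
  rw [b.starProjection_eq_sum_rankOne]
  simp

lemma sum_norm_inner_sq_le {F : Submodule ℂ H} [F.HasOrthogonalProjection] {ι : Type*}
    [Fintype ι] (b : OrthonormalBasis ι ℂ F) (x : H) :
    ∑ i, ‖⟪(b i : H), x⟫_ℂ‖ ^ 2 ≤ ‖x‖ ^ 2 :=
  (F.subtypeₗᵢ.orthonormal_comp_iff.2 b.orthonormal).sum_inner_products_le x (s := Finset.univ)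

lemma norm_map_sub_starProjection_le {A : H →L[ℂ] H} {D : ℝ} (hD : 0 ≤ D) {F : Submodule ℂ H}
    [F.HasOrthogonalProjection] (hF : ∀ x ∈ Fᗮ, ‖A x‖ ≤ D * ‖x‖) (x : H) :
    ‖A (x - F.starProjection x)‖ ≤ D * ‖x‖ := by
  refine (hF _ (F.sub_starProjection_mem_orthogonal x)).trans ?_
  gcongr
  rw [← Submodule.starProjection_orthogonal_val]
  exact Fᗮ.norm_starProjection_apply_le x

/-- The part of the compression of `A` orthogonal to the spectral subspace for the large
eigenvalues contributes little to the trace. -/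
lemma WeakDecay.norm_sum_inner_orthogonal_le [CompleteSpace H] {C : ℝ} {A : H →L[ℂ] H}
    (hC : 0 < C) {n N : ℕ} (hN : 0 < N) (hn : n ≤ 2 * N)
    {F V : Submodule ℂ H} [FiniteDimensional ℂ F] [FiniteDimensional ℂ V]
    (hV : V = outerSpace (A : End ℂ H) (2 * C / N))
    (hF : ∀ x ∈ Fᗮ, ‖A x‖ ≤ C / N * ‖x‖) (b : OrthonormalBasis (Fin n) ℂ F)
    (hb : ∀ i, ‖A (b i)‖ ≤ C / ((i : ℕ) + 1)) :
    ‖∑ i, ⟪(b i : H), A (b i) - V.starProjection (A (b i))⟫_ℂ‖ ≤ 8 * Real.log 8 * C := by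
  have hN' : (0 : ℝ) < N := by exact_mod_cast hN
  set Q : H →L[ℂ] H := Vᗮ.starProjection with hQ
  have hQV : ∀ x, x - V.starProjection x = Q x := fun x => by
    rw [hQ, Submodule.starProjection_orthogonal_val]
  have hQle : ∀ x, ‖Q x‖ ≤ ‖x‖ := Vᗮ.norm_starProjection_apply_le
  have hQQ : ∀ x, Q (Q x) = Q x := fun x =>
    Submodule.starProjection_eq_self_iff.2 (Submodule.starProjection_apply_mem _ _)
  have hQsymm : ∀ x y, ⟪Q x, y⟫_ℂ = ⟪x, Q y⟫_ℂ := Vᗮ.inner_starProjection_left_eq_right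
  set S : H →L[ℂ] H := A - A * F.starProjection with hS
  have hSle : ∀ x, ‖S x‖ ≤ C / N * ‖x‖ := by
    intro x
    have h1 : S x = A (x - F.starProjection x) := by simp [hS]
    rw [h1]
    exact norm_map_sub_starProjection_le (by positivity) hF x
  have hR : ‖Q * S * Q‖ ≤ C / N := by
    refine ContinuousLinearMap.opNorm_le_bound _ (by positivity) fun x => ?_
    refine (hQle _).trans ((hSle _).trans ?_)
    gcongr
    exact hQle x
  have key := norm_sum_inner_le_of_forall_eq_zero hC hN hn (Q * S * Q) hR
    (fun j => Q (A (b j))) (fun j => Q (b j)) (fun j => (hQle _).trans (hb j))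
    (fun x => by
      simp only [hQsymm]
      refine (sum_norm_inner_sq_le b (Q x)).trans ?_
      gcongr
      exact hQle x) ?_
  · simpa only [hQV, hQsymm, hQQ] using key
  · intro z hz η hη
    rcases eq_or_ne z 0 with rfl | hz0
    · simpa using hη
    have h1 : ∑ j, ⟪Q (b j), η⟫_ℂ • Q (A (b j)) = Q (A (F.starProjection (Q η))) := by
      rw [starProjection_apply_eq_sum b, map_sum, map_sum]
      simp only [map_smul, hQsymm]
    rw [h1] at hη
    have h2 : (Q * S * Q) η + Q (A (F.starProjection (Q η))) = Q (A (Q η)) := by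
      simp [hS]
    rw [h2] at hη
    have hQη : Q η = η := by
      conv_lhs => rw [hη, map_smul, hQQ]
      exact hη.symm
    rw [hQη] at hη
    have hmem : η ∈ V := by
      rw [hV]
      refine mem_outerSpace_of_map_sub_smul_mem (μ := z⁻¹) _ ?_ ?_
      · rw [norm_inv, lt_inv_comm₀ (by positivity) (norm_pos_iff.2 hz0)]
        rwa [inv_div]
      · have h3 : (A : End ℂ H) η - z⁻¹ • η = V.starProjection (A η) := by
          have h4 : z⁻¹ • η = Q (A η) := by
            conv_lhs => rw [hη]
            rw [inv_smul_smul₀ hz0]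
          rw [h4, ← hQV]
          simp
        rw [h3, ← hV]
        exact Submodule.starProjection_apply_mem _ _
    have hperp : η ∈ Vᗮ := Submodule.starProjection_eq_self_iff.1 hQη
    simpa using inner_self_eq_zero.1 (Submodule.inner_right_of_mem_orthogonal hmem hperp)

/-- The part of the compression of `A` along a finite-dimensional invariant subspace `V` has
nearly the trace of `A` on `V`. -/
lemma norm_sum_inner_starProjection_sub_trace_le {A : H →L[ℂ] H} {D : ℝ}
    {F V : Submodule ℂ H} [FiniteDimensional ℂ F] [FiniteDimensional ℂ V]
    (hF : ∀ x ∈ Fᗮ, ‖A x‖ ≤ D * ‖x‖) (hD : 0 ≤ D) {n : ℕ} (b : OrthonormalBasis (Fin n) ℂ F)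
    (hV : ∀ x ∈ V, (A : End ℂ H) x ∈ V) :
    ‖∑ i, ⟪(b i : H), V.starProjection (A (b i))⟫_ℂ -
      LinearMap.trace ℂ V ((A : End ℂ H).restrict hV)‖ ≤ finrank ℂ V * D := by
  let v := stdOrthonormalBasis ℂ V
  have h1 : ∑ i, ⟪(b i : H), V.starProjection (A (b i))⟫_ℂ =
      ∑ k, ⟪(v k : H), A (F.starProjection (v k))⟫_ℂ := by
    simp only [starProjection_apply_eq_sum v, starProjection_apply_eq_sum b, inner_sum, map_sum,
      map_smul, inner_smul_right]
    rw [Finset.sum_comm]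
    exact Finset.sum_congr rfl fun _ _ => Finset.sum_congr rfl fun _ _ => mul_comm _ _
  have h2 : LinearMap.trace ℂ V ((A : End ℂ H).restrict hV) = ∑ k, ⟪(v k : H), A (v k)⟫_ℂ := by
    rw [LinearMap.trace_eq_sum_inner _ v]
    rfl
  rw [h1, h2, ← Finset.sum_sub_distrib]
  refine (norm_sum_le _ _).trans ?_
  have h3 : ∀ k ∈ Finset.univ, ‖⟪(v k : H), A (F.starProjection (v k))⟫_ℂ -
      ⟪(v k : H), A (v k)⟫_ℂ‖ ≤ D := by
    intro k _
    have hvk : ‖(v k : H)‖ = 1 := v.orthonormal.1 k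
    rw [norm_sub_rev, ← inner_sub_right, ← map_sub]
    have h4 := norm_map_sub_starProjection_le hD hF (v k)
    have h5 := norm_inner_le_norm (𝕜 := ℂ) (v k : H) (A (v k - F.starProjection (v k)))
    rw [hvk] at h4 h5
    linarith
  simpa using Finset.sum_le_card_nsmul _ _ _ h3

/-- The partial sums of the eigenvalues and the sum of the large eigenvalues are comparable. -/
lemma WeakDecay.norm_sum_sub_sum_range_le {C : ℝ} {A : H →L[ℂ] H} (h : WeakDecay C A)
    (hC : 0 < C) {lam : ℕ → ℂ} (hlam : IsEigenvalueSequence A lam) {N : ℕ} (hN : 0 < N)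
    {J : Finset ℕ} (hJ : ∀ j, j ∈ J ↔ 2 * C / N < ‖lam j‖)
    (hJc : J.card * (2 * C / N) ≤ C * Real.exp 1) :
    ‖∑ j ∈ J, lam j - ∑ j ∈ Finset.range N, lam j‖ ≤ (Real.exp 1 ^ 2 / 2 + 2) * C := by
  have hN' : (0 : ℝ) < N := by exact_mod_cast hN
  rw [← Finset.sum_sdiff_sub_sum_sdiff]
  have h1 : ‖∑ j ∈ J \ Finset.range N, lam j‖ ≤ Real.exp 1 ^ 2 / 2 * C := by
    calc _ ≤ ∑ j ∈ J \ Finset.range N, ‖lam j‖ := norm_sum_le _ _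
      _ ≤ (J \ Finset.range N).card • (C * Real.exp 1 / N) := by
        refine Finset.sum_le_card_nsmul _ _ _ fun j hj => ?_
        refine (h.norm_eigenvalue_le hC hlam j).trans ?_
        have : (N : ℝ) ≤ j := by
          have := (Finset.mem_sdiff.1 hj).2
          rw [Finset.mem_range, not_lt] at this
          exact_mod_cast this
        gcongr
        linarith
      _ ≤ J.card * (C * Real.exp 1 / N) := by
        rw [nsmul_eq_mul]
        gcongr
        exact Finset.sdiff_subset
      _ = J.card * (2 * C / N) * (Real.exp 1 / 2) := by ring
      _ ≤ C * Real.exp 1 * (Real.exp 1 / 2) := by gcongr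
      _ = _ := by ring
  have h2 : ‖∑ j ∈ Finset.range N \ J, lam j‖ ≤ 2 * C := by
    calc _ ≤ ∑ j ∈ Finset.range N \ J, ‖lam j‖ := norm_sum_le _ _
      _ ≤ (Finset.range N \ J).card • (2 * C / N) := by
        refine Finset.sum_le_card_nsmul _ _ _ fun j hj => ?_
        exact not_lt.1 (mt (hJ j).2 (Finset.mem_sdiff.1 hj).2)
      _ ≤ (Finset.range N).card * (2 * C / N) := by
        rw [nsmul_eq_mul]
        gcongr
        exact Finset.sdiff_subset
      _ = 2 * C := by rw [Finset.card_range]; field_simp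
  refine (norm_sub_le _ _).trans ?_
  linarith

/-- The partial sums of the eigenvalues of `A` agree, up to a bounded error, with the traces of
compressions of `A`. -/
lemma WeakDecay.norm_compressionTrace_sub_sum_le [CompleteSpace H] {C : ℝ} {A : H →L[ℂ] H}
    (h : WeakDecay C A) (hC : 0 < C) {lam : ℕ → ℂ} (hlam : IsEigenvalueSequence A lam) {N : ℕ}
    (hN : 0 < N) (F : Submodule ℂ H) [FiniteDimensional ℂ F] (hFN : finrank ℂ F ≤ 2 * N)
    (hF : ∀ x ∈ Fᗮ, ‖A x‖ ≤ C / N * ‖x‖) :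
    ‖compressionTrace F A - ∑ j ∈ Finset.range N, lam j‖ ≤
      (8 * Real.log 8 + Real.exp 1 / 2 + (Real.exp 1 ^ 2 / 2 + 2)) * C := by
  have hN' : (0 : ℝ) < N := by exact_mod_cast hN
  have hr : 0 < 2 * C / N := by positivity
  obtain ⟨b, hb⟩ := h.exists_orthonormalBasis F rfl
  have hfd := h.finiteDimensional_outerSpace hC hr
  obtain ⟨J, hJ, hJc, hJsum⟩ := hlam.exists_finset hr.le
  have hVA : ∀ x ∈ outerSpace (A : End ℂ H) (2 * C / N),
      (A : End ℂ H) x ∈ outerSpace (A : End ℂ H) (2 * C / N) :=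
    fun _ hx => map_mem_outerSpace _ _ hx
  have hdim := h.finrank_mul_le hC hr _ hVA le_rfl
  have h1 := WeakDecay.norm_sum_inner_orthogonal_le hC hN hFN rfl hF b hb
  have h2 := norm_sum_inner_starProjection_sub_trace_le hF (by positivity) b hVA
  rw [← hJsum] at h2
  have h3 := h.norm_sum_sub_sum_range_le hC hlam hN hJ (by rw [hJc]; exact hdim)
  have h4 : (finrank ℂ (outerSpace (A : End ℂ H) (2 * C / N)) : ℝ) * (C / N) ≤
      Real.exp 1 / 2 * C := by
    have : (finrank ℂ (outerSpace (A : End ℂ H) (2 * C / N)) : ℝ) * (C / N) =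
      finrank ℂ (outerSpace (A : End ℂ H) (2 * C / N)) * (2 * C / N) / 2 := by ring
    rw [this]
    linarith
  have h5 := norm_add₃_le.trans (add_le_add (add_le_add h1 (h2.trans h4)) h3)
  refine le_trans (le_of_eq ?_) (h5.trans_eq (by ring))
  rw [compressionTrace_eq_sum b]
  simp only [inner_sub_right, Finset.sum_sub_distrib]
  congr 1
  ring

end TraceComparison

section LogarithmicMeans

lemma cesaro_add (a b : ℕ → ℂ) : cesaro (a + b) = cesaro a + cesaro b := by
  ext N
  simp [cesaro, Finset.sum_add_distrib, mul_add]

lemma cesaro_smul (c : ℂ) (a : ℕ → ℂ) : cesaro (c • a) = c • cesaro a := by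
  ext N
  simp only [cesaro, Pi.smul_apply, smul_eq_mul, ← Finset.mul_sum]
  ring

lemma tendsto_cesaro_zero {a : ℕ → ℂ} {K : ℝ}
    (hK : ∀ N, 0 < N → ‖∑ j ∈ Finset.range N, a j‖ ≤ K) : Tendsto (cesaro a) atTop (nhds 0) := by
  have h1 : Tendsto (fun N : ℕ => (Real.log ((N : ℝ) + 1))⁻¹ * K) atTop (nhds 0) := by
    rw [← zero_mul K]
    exact ((Real.tendsto_log_atTop.comp
      (tendsto_atTop_add_const_right _ 1 tendsto_natCast_atTop_atTop)).inv_tendsto_atTop).mul_const K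
  refine squeeze_zero_norm' ?_ h1
  filter_upwards [eventually_gt_atTop 0] with N hN
  have h2 : 0 ≤ (Real.log ((N : ℝ) + 1))⁻¹ :=
    inv_nonneg.2 (Real.log_nonneg (by linarith [(Nat.cast_nonneg N : (0 : ℝ) ≤ N)]))
  rw [cesaro, norm_mul, Complex.norm_real, Real.norm_of_nonneg h2]
  gcongr
  exact hK N hN

lemma exists_norm_cesaro_le {a : ℕ → ℂ} {C : ℝ} (ha : ∀ j, ‖a j‖ ≤ C / (j + 1)) :
    ∃ K : ℝ, ∀ N, ‖cesaro a N‖ ≤ K := by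
  have hC : 0 ≤ C := by simpa using (norm_nonneg _).trans (ha 0)
  have hlog2 : 0 < Real.log 2 := Real.log_pos (by norm_num)
  refine ⟨C * ((Real.log 2)⁻¹ + 1), fun N => ?_⟩
  rcases Nat.eq_zero_or_pos N with rfl | hN
  · simp only [cesaro, Finset.range_zero, Finset.sum_empty, mul_zero, norm_zero]
    positivity
  have hN1 : (1 : ℝ) ≤ N := by exact_mod_cast hN
  have hlog : Real.log 2 ≤ Real.log ((N : ℝ) + 1) := Real.log_le_log (by norm_num) (by linarith)
  have hpos : 0 < Real.log ((N : ℝ) + 1) := hlog2.trans_le hlog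
  have hsum : ‖∑ j ∈ Finset.range N, a j‖ ≤ C * (1 + Real.log N) := by
    calc _ ≤ ∑ j ∈ Finset.range N, C / ((j : ℝ) + 1) :=
          norm_sum_le_of_le _ fun j _ => ha j
      _ = C * (harmonic N : ℝ) := by
        simp [harmonic, Finset.mul_sum, div_eq_mul_inv]
      _ ≤ _ := by gcongr; exact harmonic_le_one_add_log N
  rw [cesaro, norm_mul, Complex.norm_real, Real.norm_of_nonneg (inv_nonneg.2 hpos.le),
    inv_mul_le_iff₀ hpos]
  refine hsum.trans ?_
  have h1 : 1 ≤ (Real.log 2)⁻¹ * Real.log ((N : ℝ) + 1) := by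
    rwa [inv_mul_eq_div, one_le_div₀ hlog2]
  have h2 : Real.log N ≤ Real.log ((N : ℝ) + 1) :=
    Real.log_le_log (by linarith) (by linarith)
  calc C * (1 + Real.log N)
      ≤ C * ((Real.log 2)⁻¹ * Real.log ((N : ℝ) + 1) + Real.log ((N : ℝ) + 1)) := by gcongr
    _ = _ := by ring

lemma IsExtendedLimit.cesaro_eq_cesaro {ω : (ℕ → ℂ) → ℂ} (hω : IsExtendedLimit ω) {a b : ℕ → ℂ}
    (hb : ∃ K : ℝ, ∀ N, ‖cesaro b N‖ ≤ K) {K : ℝ}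
    (hK : ∀ N, 0 < N → ‖∑ j ∈ Finset.range N, a j - ∑ j ∈ Finset.range N, b j‖ ≤ K) :
    ω (cesaro a) = ω (cesaro b) := by
  have h1 : Tendsto (cesaro (a - b)) atTop (nhds 0) :=
    tendsto_cesaro_zero (K := K) fun N hN => by
      simpa [Finset.sum_sub_distrib] using hK N hN
  have h2 : ∃ K : ℝ, ∀ N, ‖cesaro (a - b) N‖ ≤ K := by
    obtain ⟨K, hK⟩ := (Metric.isBounded_range_of_tendsto _ h1).exists_norm_le
    exact ⟨K, fun N => hK _ ⟨N, rfl⟩⟩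
  rw [← sub_add_cancel a b, cesaro_add, hω.map_add _ _ h2 hb, hω.vanishing _ h1, zero_add]

lemma exists_nonneg_cesaro {a : ℕ → ℂ} (ha : ∀ j, ∃ r : ℝ, 0 ≤ r ∧ a j = r) (N : ℕ) :
    ∃ r : ℝ, 0 ≤ r ∧ cesaro a N = r := by
  choose r hr har using ha
  refine ⟨(Real.log ((N : ℝ) + 1))⁻¹ * ∑ j ∈ Finset.range N, r j, ?_, by simp [cesaro, har]⟩
  have : 0 ≤ Real.log ((N : ℝ) + 1) :=
    Real.log_nonneg (by linarith [(Nat.cast_nonneg N : (0 : ℝ) ≤ N)])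
  exact mul_nonneg (inv_nonneg.2 this) (Finset.sum_nonneg fun j _ => hr j)

end LogarithmicMeans

section DixmierTrace

open Module

variable {H : Type u} [NormedAddCommGroup H] [InnerProductSpace ℂ H]

lemma WeakDecay.exists_norm_cesaro_le {C : ℝ} {A : H →L[ℂ] H} (h : WeakDecay C A) (hC : 0 < C)
    {lam : ℕ → ℂ} (hlam : IsEigenvalueSequence A lam) : ∃ K : ℝ, ∀ N, ‖cesaro lam N‖ ≤ K :=
  _root_.exists_norm_cesaro_le (h.norm_eigenvalue_le hC hlam)

lemma WeakDecay.exists_submodule {C : ℝ} {A : H →L[ℂ] H} (h : WeakDecay C A) (hC : 0 ≤ C) {N : ℕ}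
    (hN : 0 < N) : ∃ E : Submodule ℂ H, FiniteDimensional ℂ E ∧ finrank ℂ E ≤ N ∧
      ∀ x ∈ Eᗮ, ‖A x‖ ≤ C / N * ‖x‖ := by
  obtain ⟨E, h1, h2, h3⟩ := h N
  refine ⟨E, h1, h2, fun x hx => (h3 x hx).trans ?_⟩
  have : (0 : ℝ) < N := by exact_mod_cast hN
  gcongr
  linarith

lemma IsEigenvalueSequence.exists_nonneg_of_isPositive {A : H →L[ℂ] H} (hA : A.IsPositive)
    {lam : ℕ → ℂ} (hlam : IsEigenvalueSequence A lam) (j : ℕ) :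
    ∃ r : ℝ, 0 ≤ r ∧ lam j = r := by
  rcases eq_or_ne (lam j) 0 with h0 | h0
  · exact ⟨0, le_rfl, by simp [h0]⟩
  have hne : Module.End.maxGenEigenspace (A : H →ₗ[ℂ] H) (lam j) ≠ ⊥ := by
    intro hbot
    have h1 := hlam.2 (lam j) h0
    rw [algMult_eq, hbot, rank_bot, Cardinal.lift_zero, Cardinal.lift_eq_zero,
      Cardinal.mk_eq_zero_iff] at h1
    exact h1.elim ⟨j, rfl⟩
  have heig : Module.End.HasEigenvalue (A : H →ₗ[ℂ] H) (lam j) :=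
    Module.End.HasUnifEigenvalue.lt zero_lt_one hne
  obtain ⟨r, hr⟩ := Complex.conj_eq_iff_real.1 (hA.isSymmetric.conj_eigenvalue_eq_self heig)
  rw [hr] at heig
  exact ⟨r, eigenvalue_nonneg_of_nonneg heig hA.re_inner_nonneg_right, hr⟩

variable [CompleteSpace H] {ω : (ℕ → ℂ) → ℂ}

lemma WeakDecay.cesaro_smul_eq (hω : IsExtendedLimit ω) {C : ℝ} {A : H →L[ℂ] H}
    (h : WeakDecay C A) (hC : 0 < C) (c : ℂ) {lam mu : ℕ → ℂ} (hlam : IsEigenvalueSequence A lam)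
    (hmu : IsEigenvalueSequence (c • A) mu) : ω (cesaro mu) = c * ω (cesaro lam) := by
  have hbdd := h.exists_norm_cesaro_le hC hlam
  have hbdd' : ∃ K : ℝ, ∀ N, ‖cesaro (c • lam) N‖ ≤ K := by
    obtain ⟨K, hK⟩ := hbdd
    refine ⟨‖c‖ * K, fun N => ?_⟩
    rw [cesaro_smul, Pi.smul_apply, norm_smul]
    gcongr
    exact hK N
  rw [← hω.map_smul _ _ hbdd, ← cesaro_smul]
  set K := 8 * Real.log 8 + Real.exp 1 / 2 + (Real.exp 1 ^ 2 / 2 + 2)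
  set D := (‖c‖ + 1) * C
  have hcD : ‖c‖ * C ≤ D := mul_le_mul_of_nonneg_right (by linarith) hC.le
  refine hω.cesaro_eq_cesaro hbdd' (K := K * D + ‖c‖ * (K * C)) fun N hN => ?_
  obtain ⟨F, hFd, hFN, hF⟩ := h.exists_submodule hC.le hN
  have h1 := h.norm_compressionTrace_sub_sum_le hC hlam hN F (by omega) hF
  have h2 := ((h.smul c).mono hcD).norm_compressionTrace_sub_sum_le (by positivity) hmu hN F
    (by omega) fun x hx => by
      rw [smul_apply, norm_smul]
      calc ‖c‖ * ‖A x‖ ≤ ‖c‖ * (C / N * ‖x‖) := by gcongr; exact hF x hx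
        _ = ‖c‖ * C / N * ‖x‖ := by ring
        _ ≤ _ := by gcongr
  rw [compressionTrace_smul, norm_sub_rev] at h2
  have h3 : ‖c * (compressionTrace F A - ∑ j ∈ Finset.range N, lam j)‖ ≤ ‖c‖ * (K * C) := by
    rw [norm_mul]; gcongr
  refine le_trans (le_of_eq ?_) ((norm_add_le _ _).trans (add_le_add h2 h3))
  simp only [Pi.smul_apply, smul_eq_mul, ← Finset.mul_sum]
  congr 1
  ring

lemma WeakDecay.cesaro_eq (hω : IsExtendedLimit ω) {C : ℝ} {A : H →L[ℂ] H}
    (h : WeakDecay C A) (hC : 0 < C) {lam mu : ℕ → ℂ} (hlam : IsEigenvalueSequence A lam)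
    (hmu : IsEigenvalueSequence A mu) : ω (cesaro lam) = ω (cesaro mu) := by
  have := h.cesaro_smul_eq hω hC 1 hmu (mu := lam) (by rwa [one_smul])
  rwa [one_mul] at this

lemma WeakDecay.cesaro_add_eq (hω : IsExtendedLimit ω) {C D : ℝ} {A B : H →L[ℂ] H}
    (hA : WeakDecay C A) (hC : 0 < C) (hB : WeakDecay D B) (hD : 0 < D) {lam mu nu : ℕ → ℂ}
    (hlam : IsEigenvalueSequence A lam) (hmu : IsEigenvalueSequence B mu)
    (hnu : IsEigenvalueSequence (A + B) nu) :
    ω (cesaro nu) = ω (cesaro lam) + ω (cesaro mu) := by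
  have hbA := hA.exists_norm_cesaro_le hC hlam
  have hbB := hB.exists_norm_cesaro_le hD hmu
  have hb : ∃ K : ℝ, ∀ N, ‖cesaro (lam + mu) N‖ ≤ K := by
    obtain ⟨K, hK⟩ := hbA
    obtain ⟨L, hL⟩ := hbB
    refine ⟨K + L, fun N => ?_⟩
    rw [cesaro_add]
    exact norm_add_le_of_le (hK N) (hL N)
  rw [← hω.map_add _ _ hbA hbB, ← cesaro_add]
  set K := 8 * Real.log 8 + Real.exp 1 / 2 + (Real.exp 1 ^ 2 / 2 + 2)
  refine hω.cesaro_eq_cesaro hb (K := K * (2 * (C + D)) + K * C + K * D) fun N hN => ?_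
  obtain ⟨E, hEd, hEN, hE⟩ := hA.exists_submodule hC.le hN
  obtain ⟨F, hFd, hFN, hF⟩ := hB.exists_submodule hD.le hN
  have hdim : finrank ℂ ↥(E ⊔ F) ≤ 2 * N := by
    have := Submodule.finrank_add_le_finrank_add_finrank E F
    omega
  have hE' : ∀ x ∈ (E ⊔ F)ᗮ, ‖A x‖ ≤ C / N * ‖x‖ := fun x hx =>
    hE x (Submodule.orthogonal_le le_sup_left hx)
  have hF' : ∀ x ∈ (E ⊔ F)ᗮ, ‖B x‖ ≤ D / N * ‖x‖ := fun x hx =>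
    hF x (Submodule.orthogonal_le le_sup_right hx)
  have h1 := hA.norm_compressionTrace_sub_sum_le hC hlam hN _ hdim hE'
  have h2 := hB.norm_compressionTrace_sub_sum_le hD hmu hN _ hdim hF'
  have h3 := (hA.add hC.le hD.le hB).norm_compressionTrace_sub_sum_le (by positivity) hnu hN _ hdim
    fun x hx => by
      calc ‖A x + B x‖ ≤ C / N * ‖x‖ + D / N * ‖x‖ := norm_add_le_of_le (hE' x hx) (hF' x hx)
        _ = (C + D) / N * ‖x‖ := by ring
        _ ≤ _ := by gcongr; linarith
  rw [compressionTrace_add, norm_sub_rev] at h3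
  refine le_trans (le_of_eq ?_) (norm_add₃_le.trans (add_le_add (add_le_add h3 h1) h2))
  simp only [Pi.add_apply, Finset.sum_add_distrib]
  congr 1
  ring

end DixmierTrace

/-- For every extended limit `ω`, the formula
`Tr_ω(A) = ω ((1/log (N+1)) ∑_{j<N} λ_j(A))` does not depend on the choice of eigenvalue
sequence and defines a positive linear trace on `𝓛_{1,∞}`: it is additive, homogeneous,
nonnegative on positive operators, and satisfies `Tr_ω(BT) = Tr_ω(TB)` for bounded `B`
and `T ∈ 𝓛_{1,∞}`. -/
theorem dixmier_trace_well_defined {H : Type u} [NormedAddCommGroup H] [InnerProductSpace ℂ H]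
    [CompleteSpace H] [TopologicalSpace.SeparableSpace H]
    (ω : (ℕ → ℂ) → ℂ) (hω : IsExtendedLimit ω) :
    (∀ A : H →L[ℂ] H, MemWeak 1 A → ∀ lam lam' : ℕ → ℂ, IsEigenvalueSequence A lam →
        IsEigenvalueSequence A lam' → ω (cesaro lam) = ω (cesaro lam')) ∧
    (∀ A B : H →L[ℂ] H, MemWeak 1 A → MemWeak 1 B →
        ∀ lamA lamB lamAB : ℕ → ℂ, IsEigenvalueSequence A lamA →
        IsEigenvalueSequence B lamB → IsEigenvalueSequence (A + B) lamAB →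
        ω (cesaro lamAB) = ω (cesaro lamA) + ω (cesaro lamB)) ∧
    (∀ (c : ℂ) (A : H →L[ℂ] H), MemWeak 1 A → ∀ lamA lamcA : ℕ → ℂ,
        IsEigenvalueSequence A lamA → IsEigenvalueSequence (c • A) lamcA →
        ω (cesaro lamcA) = c * ω (cesaro lamA)) ∧
    (∀ A : H →L[ℂ] H, MemWeak 1 A → A.IsPositive → ∀ lamA : ℕ → ℂ,
        IsEigenvalueSequence A lamA → ∃ r : ℝ, 0 ≤ r ∧ ω (cesaro lamA) = r) ∧
    (∀ B T : H →L[ℂ] H, MemWeak 1 T → ∀ lam₁ lam₂ : ℕ → ℂ,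
        IsEigenvalueSequence (B * T) lam₁ → IsEigenvalueSequence (T * B) lam₂ →
        ω (cesaro lam₁) = ω (cesaro lam₂)) := by
  refine ⟨fun A hA lam lam' hlam hlam' => ?_, fun A B hA hB lamA lamB lamAB h₁ h₂ h₃ => ?_,
    fun c A hA lamA lamcA h₁ h₂ => ?_, fun A hA hpos lamA hlam => ?_,
    fun B T hT lam₁ lam₂ h₁ h₂ => ?_⟩
  · obtain ⟨C, hC, h⟩ := hA.exists_weakDecay
    exact h.cesaro_eq hω hC hlam hlam'
  · obtain ⟨C, hC, hA⟩ := hA.exists_weakDecay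
    obtain ⟨D, hD, hB⟩ := hB.exists_weakDecay
    exact hA.cesaro_add_eq hω hC hB hD h₁ h₂ h₃
  · obtain ⟨C, hC, h⟩ := hA.exists_weakDecay
    exact h.cesaro_smul_eq hω hC c h₁ h₂
  · obtain ⟨C, hC, h⟩ := hA.exists_weakDecay
    exact hω.pos _ (h.exists_norm_cesaro_le hC hlam)
      (exists_nonneg_cesaro (hlam.exists_nonneg_of_isPositive hpos))
  · obtain ⟨C, hC, h⟩ := hT.exists_weakDecay
    have h' : WeakDecay ((‖B‖ + 1) * C) (B * T) :=
      (h.comp_left B).mono (mul_le_mul_of_nonneg_right (by linarith) hC.le)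
    exact h'.cesaro_eq hω (by positivity) h₁ h₂.mul_comm
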